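/- Define c_d(x, y, z) = c(x − 2·p(x), z, y). Then for every n ∈ ℤ and all y, z ∈ ℝ, c_d(2n, y, z) = y and c_d(2n+1, y, z) = z; that is, c_d is an extension to ℝ of the discrete conditional that returns y on even integers and z on odd integers. -/

import Mathlib

noncomputable def parity (x : ℝ) : ℝ := max 0 (Real.pi / 2 * Real.sin (Real.pi * x))

noncomputable def pfun (x : ℝ) : ℝ := ∫ t in (0:ℝ)..(x - 1), parity t

def c (x y z : ℝ) : ℝ := x * y + (1 - x) * z

noncomputable def c_d (x y z : ℝ) : ℝ := c (x - 2 * pfun x) z y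

lemma continuous_parity : Continuous parity := by
  unfold parity
  fun_prop

lemma parity_periodic : Function.Periodic parity 2 := by
  intro x
  have h : Real.pi * (x + 2) = Real.pi * x + 2 * Real.pi := by ring
  simp only [parity, h, Real.sin_add_two_pi]

lemma parity_eq_zero_of_mem_Icc {x : ℝ} (hx : x ∈ Set.Icc (-1 : ℝ) 0) : parity x = 0 := by
  refine max_eq_left (mul_nonpos_of_nonneg_of_nonpos (by positivity) ?_)
  apply Real.sin_nonpos_of_nonpos_of_neg_pi_le
  · nlinarith [Real.pi_pos, hx.2]
  · nlinarith [Real.pi_pos, hx.1]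

lemma parity_eq_sin_of_mem_Icc {x : ℝ} (hx : x ∈ Set.Icc (0 : ℝ) 1) :
    parity x = Real.pi / 2 * Real.sin (Real.pi * x) := by
  refine max_eq_right (mul_nonneg (by positivity) ?_)
  apply Real.sin_nonneg_of_nonneg_of_le_pi
  · nlinarith [Real.pi_pos, hx.1]
  · nlinarith [Real.pi_pos, hx.2]

lemma integral_parity_neg_one_zero : ∫ t in (-1 : ℝ)..0, parity t = 0 := by
  rw [intervalIntegral.integral_congr (g := fun _ => (0 : ℝ)), intervalIntegral.integral_zero]
  intro x hx
  rw [Set.uIcc_of_le (by norm_num)] at hx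
  exact parity_eq_zero_of_mem_Icc hx

lemma integral_parity_zero_one : ∫ t in (0 : ℝ)..1, parity t = 1 := by
  rw [intervalIntegral.integral_congr
    (g := fun x => Real.pi / 2 * Real.sin (Real.pi * x))]
  · rw [intervalIntegral.integral_const_mul,
      intervalIntegral.integral_comp_mul_left _ Real.pi_ne_zero, integral_sin]
    simp
    field_simp
    norm_num
  · intro x hx
    rw [Set.uIcc_of_le (by norm_num)] at hx
    exact parity_eq_sin_of_mem_Icc hx

lemma integral_parity_period : ∫ t in (0 : ℝ)..2, parity t = 1 := by
  have h := parity_periodic.intervalIntegral_add_eq 0 (-1)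
  norm_num at h
  rw [h, ← intervalIntegral.integral_add_adjacent_intervals
    (continuous_parity.intervalIntegrable (-1) 0) (continuous_parity.intervalIntegrable 0 1),
    integral_parity_neg_one_zero, integral_parity_zero_one, zero_add]

lemma integral_parity_add_two_mul_int (a : ℝ) (n : ℤ) :
    ∫ t in a..(a + 2 * n), parity t = n := by
  have h := parity_periodic.intervalIntegral_add_zsmul_eq n a
    (fun a b => continuous_parity.intervalIntegrable a b)
  rw [parity_periodic.intervalIntegral_add_eq a 0, zero_add, integral_parity_period] at h
  simpa [mul_comm] using h

lemma pfun_two_mul_int (n : ℤ) : pfun (2 * n) = n := by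
  have h : (2 * n - 1 : ℝ) = -1 + 2 * n := by ring
  rw [pfun, h, ← intervalIntegral.integral_add_adjacent_intervals
    (continuous_parity.intervalIntegrable 0 (-1)) (continuous_parity.intervalIntegrable (-1) _),
    intervalIntegral.integral_symm, integral_parity_neg_one_zero,
    integral_parity_add_two_mul_int, neg_zero, zero_add]

lemma pfun_two_mul_int_add_one (n : ℤ) : pfun (2 * n + 1) = n := by
  simpa [pfun] using integral_parity_add_two_mul_int 0 n

theorem c_d_discrete_conditional (n : ℤ) (y z : ℝ) :
    c_d (2*n) y z = y ∧ c_d (2*n + 1) y z = z := by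
  rw [c_d, c_d, pfun_two_mul_int, pfun_two_mul_int_add_one, c, c]
  constructor <;> ring
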